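/- Let d, r, M, N, s be positive integers and suppose that every finite family of finite sets, each of cardinality at most d, with more than M members contains an r-sunflower. Then every family F of nonempty subsets of a universe U with |U| = N, where every set in F has cardinality at most d and |F| > M·s·N, contains s many r-sunflowers with pairwise distinct, nonempty cores; that is, there exist s distinct nonempty sets C_1, …, C_s such that each C_i is the core of some r-sunflower contained in F. -/

import Mathlib

/-- `S` is an `r`-sunflower with core `C`: it consists of `r` (distinct) sets, and any two
distinct members intersect exactly in `C`. -/
def IsSunflower {β : Type*} [DecidableEq β] (r : ℕ) (S : Finset (Finset β)) (C : Finset β) :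
    Prop :=
  S.card = r ∧ ∀ A ∈ S, ∀ B ∈ S, A ≠ B → A ∩ B = C

namespace IsSunflower

variable {β : Type*} [DecidableEq β] {r : ℕ} {S : Finset (Finset β)} {C : Finset β}

lemma exists_inter_eq (h : IsSunflower r S C) (hr : 2 ≤ r) :
    ∃ A ∈ S, ∃ B ∈ S, A ∩ B = C := by
  obtain ⟨A, hA, B, hB, hAB⟩ := Finset.one_lt_card.mp (by rw [h.1]; omega : 1 < S.card)
  exact ⟨A, hA, B, hB, h.2 A hA B hB hAB⟩

lemma exists_core_subset (h : IsSunflower r S C) (hr : 2 ≤ r) : ∃ A ∈ S, C ⊆ A := by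
  obtain ⟨A, hA, B, -, rfl⟩ := h.exists_inter_eq hr
  exact ⟨A, hA, Finset.inter_subset_left⟩

lemma subset_core (h : IsSunflower r S C) (hr : 2 ≤ r) {X : Finset β}
    (hX : ∀ A ∈ S, X ⊆ A) : X ⊆ C := by
  obtain ⟨A, hA, B, hB, rfl⟩ := h.exists_inter_eq hr
  exact Finset.subset_inter (hX A hA) (hX B hB)

end IsSunflower

section Cores

variable {U : Type*} [DecidableEq U] [Fintype U] {r M : ℕ}

/-- A large family of proper supersets of `C` contains a sunflower whose core is a proper
superset of `C`. -/
lemma exists_sunflower_core_ssuperset (hr : 2 ≤ r) {F : Finset (Finset U)} {C : Finset U}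
    (hsf : ∀ G ⊆ F, M < G.card → ∃ S ⊆ G, ∃ D : Finset U, IsSunflower r S D)
    (hC : ∀ A ∈ F, C ⊂ A) (hF : Cᶜ.card * M < F.card) :
    ∃ D, C ⊂ D ∧ ∃ S ⊆ F, IsSunflower r S D := by
  have hpt : ∀ A : Finset U, ∃ v : U, A ∈ F → v ∈ A ∧ v ∉ C := by
    intro A
    by_cases hA : A ∈ F
    · obtain ⟨v, hv⟩ := Finset.exists_of_ssubset (hC A hA)
      exact ⟨v, fun _ => hv⟩
    · have : 0 < F.card := by omega
      obtain ⟨B, hB⟩ := Finset.card_pos.mp this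
      obtain ⟨v, -⟩ := Finset.exists_of_ssubset (hC B hB)
      exact ⟨v, fun h => absurd h hA⟩
  choose f hf using hpt
  obtain ⟨v, hv, hlt⟩ := Finset.exists_lt_card_fiber_of_mul_lt_card_of_maps_to
    (f := f) (t := Cᶜ) (fun A hA => Finset.mem_compl.mpr (hf A hA).2) hF
  obtain ⟨S, hS, D, hD⟩ := hsf _ (Finset.filter_subset _ _) hlt
  have hsub : insert v C ⊆ D := hD.subset_core hr fun A hA => by
    obtain ⟨hAF, rfl⟩ := Finset.mem_filter.mp (hS hA)
    exact Finset.insert_subset (hf A hAF).1 (hC A hAF).1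
  exact ⟨D, (Finset.ssubset_insert (Finset.mem_compl.mp hv)).trans_subset hsub,
    S, hS.trans (Finset.filter_subset _ _), hD⟩

/-- A family of nonempty sets that is large compared to `B.card` contains a sunflower with a
nonempty core outside `B`. -/
lemma exists_sunflower_core_notMem (hr : 2 ≤ r) (hM : 0 < M) (B : Finset (Finset U))
    (hB : ∀ C ∈ B, C.Nonempty) (F : Finset (Finset U))
    (hsf : ∀ G ⊆ F, M < G.card → ∃ S ⊆ G, ∃ D : Finset U, IsSunflower r S D)
    (hne : ∀ A ∈ F, A.Nonempty) (hF : Fintype.card U * M * (B.card + 1) < F.card) :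
    ∃ D : Finset U, D.Nonempty ∧ D ∉ B ∧ ∃ S ⊆ F, IsSunflower r S D := by
  induction hn : B.card generalizing B F with
  | zero =>
    obtain rfl := Finset.card_eq_zero.mp hn
    obtain ⟨D, hD, hS⟩ := exists_sunflower_core_ssuperset (C := ∅) hr hsf
      (fun A hA => Finset.empty_ssubset.mpr (hne A hA)) (by simpa using hF)
    exact ⟨D, Finset.empty_ssubset.mp hD, Finset.notMem_empty D, hS⟩
  | succ n ih =>
    by_cases hlight : ∃ C ∈ B, (F.filter (C ⊆ ·)).card ≤ Fintype.card U * M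
    · obtain ⟨C, hCB, hC⟩ := hlight
      have hsub : F.filter (¬ C ⊆ ·) ⊆ F := Finset.filter_subset _ _
      have hcard : (B.erase C).card = n := by rw [Finset.card_erase_of_mem hCB, hn]; rfl
      have hsplit := Finset.card_filter_add_card_filter_not (s := F) (C ⊆ ·)
      obtain ⟨D, hD, hDB, S, hS, hSD⟩ := ih (B.erase C)
        (fun A hA => hB A (Finset.mem_of_mem_erase hA)) (F.filter (¬ C ⊆ ·))
        (fun G hG => hsf G (hG.trans hsub)) (fun A hA => hne A (hsub hA))
        (by rw [hcard]; rw [hn] at hF; linarith) hcard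
      refine ⟨D, hD, fun hmem => hDB (Finset.mem_erase.mpr ⟨?_, hmem⟩), S, hS.trans hsub, hSD⟩
      rintro rfl
      obtain ⟨A, hA, hDA⟩ := hSD.exists_core_subset hr
      exact (Finset.mem_filter.mp (hS hA)).2 hDA
    · push Not at hlight
      obtain ⟨C, hC⟩ := B.exists_maximal (Finset.card_pos.mp (by omega))
      have hsub : F.filter (C ⊂ ·) ⊆ F := Finset.filter_subset _ _
      have hins : F.filter (C ⊆ ·) ⊆ insert C (F.filter (C ⊂ ·)) := by
        intro A hA
        obtain ⟨hAF, hCA⟩ := Finset.mem_filter.mp hA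
        rcases hCA.eq_or_ssubset with rfl | h
        · exact Finset.mem_insert_self _ _
        · exact Finset.mem_insert_of_mem (Finset.mem_filter.mpr ⟨hAF, h⟩)
      have hle := (Finset.card_le_card hins).trans (Finset.card_insert_le _ _)
      have hheavy := hlight C hC.prop
      have hpos := Finset.card_pos.mpr (hB C hC.prop)
      have hcompl := Finset.card_add_card_compl C
      have hlt : Cᶜ.card * M < (F.filter (C ⊂ ·)).card := by nlinarith
      obtain ⟨D, hCD, S, hS, hSD⟩ := exists_sunflower_core_ssuperset hr
        (fun G hG => hsf G (hG.trans hsub)) (fun A hA => (Finset.mem_filter.mp hA).2) hlt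
      exact ⟨D, (hB C hC.prop).mono hCD.1, fun hD => hCD.2 (hC.le_of_ge hD hCD.1),
        S, hS.trans hsub, hSD⟩

end Cores

/-- Suppose every family of more than `M` sets, each of cardinality at most `d`, contains an
`r`-sunflower.  Then every family `F` of nonempty subsets of a universe `U` with `|U| = N`,
each of cardinality at most `d`, with `|F| > M·s·N`, contains `s` many `r`-sunflowers with
pairwise distinct, nonempty cores. -/
theorem many_sunflowers_with_distinct_nonempty_cores (d r M N s : ℕ)
    (hd : 0 < d) (hr : 0 < r) (hM : 0 < M) (hN : 0 < N) (hs : 0 < s)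
    (hsf : ∀ (β : Type) [DecidableEq β] (G : Finset (Finset β)),
      (∀ A ∈ G, A.card ≤ d) → M < G.card → ∃ S ⊆ G, ∃ C : Finset β, IsSunflower r S C)
    (U : Type) [DecidableEq U] [Fintype U] (hU : Fintype.card U = N)
    (F : Finset (Finset U))
    (hne : ∀ A ∈ F, A.Nonempty)
    (hcard : ∀ A ∈ F, A.card ≤ d)
    (hbig : M * s * N < F.card) :
    ∃ Cs : Finset (Finset U), Cs.card = s ∧
      ∀ C ∈ Cs, C.Nonempty ∧ ∃ S ⊆ F, IsSunflower r S C := by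
  rcases (by omega : r = 1 ∨ 2 ≤ r) with rfl | hr2
  · have hsF : s ≤ F.card := by
      have : s * 1 ≤ s * (M * N) := Nat.mul_le_mul_left s (Nat.mul_pos hM hN)
      linarith
    obtain ⟨Cs, hCs, hcs⟩ := Finset.exists_subset_card_eq hsF
    refine ⟨Cs, hcs, fun C hC => ⟨hne C (hCs hC), {C}, by simpa using hCs hC, by simp, ?_⟩⟩
    intro A hA B hB hAB
    exact absurd ((Finset.mem_singleton.mp hA).trans (Finset.mem_singleton.mp hB).symm) hAB
  · have hF : ∀ G ⊆ F, M < G.card → ∃ S ⊆ G, ∃ D : Finset U, IsSunflower r S D :=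
      fun G hG => hsf U G fun A hA => hcard A (hG hA)
    suffices h : ∀ k ≤ s, ∃ Cs : Finset (Finset U), Cs.card = k ∧
        ∀ C ∈ Cs, C.Nonempty ∧ ∃ S ⊆ F, IsSunflower r S C from h s le_rfl
    intro k
    induction k with
    | zero => exact fun _ => ⟨∅, by simp⟩
    | succ k ih =>
      intro hk
      obtain ⟨Cs, hcs, hCs⟩ := ih (by omega)
      obtain ⟨D, hD, hDCs, hS⟩ := exists_sunflower_core_notMem hr2 hM Cs
        (fun C hC => (hCs C hC).1) F hF hne (by
          rw [hU, hcs]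
          have := Nat.mul_le_mul_left (N * M) hk
          linarith)
      refine ⟨insert D Cs, by rw [Finset.card_insert_of_notMem hDCs, hcs], fun C hC => ?_⟩
      rcases Finset.mem_insert.mp hC with rfl | hC
      · exact ⟨hD, hS⟩
      · exact hCs C hC
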